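/- Let A be an n × n orthogonal matrix over the finite field F_q (A Aᵀ = I_n) and let A_k be the k × n submatrix obtained from A by keeping any k of its rows. Then the row space of A_k is an LCD code of dimension k over F_q. -/

import Mathlib

/-- The Euclidean dual of a code `C ⊆ R^n`:
`C^⊥ = {x : x · c = 0 for all c ∈ C}` where `x · y = ∑ i, x i * y i`. -/
def dualCode {R : Type*} [CommRing R] {n : ℕ} (C : Submodule R (Fin n → R)) :
    Submodule R (Fin n → R) where
  carrier := {x | ∀ c ∈ C, ∑ i, x i * c i = 0}
  zero_mem' := by intro c hc; simp
  add_mem' := by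
    intro a b ha hb c hc
    have h1 := ha c hc
    have h2 := hb c hc
    simp only [Pi.add_apply, add_mul, Finset.sum_add_distrib, h1, h2, add_zero]
  smul_mem' := by
    intro r x hx c hc
    have h1 := hx c hc
    simp only [Pi.smul_apply, smul_eq_mul, mul_assoc, ← Finset.mul_sum, h1, mul_zero]

/-- A code is LCD (linear complementary dual) if `C ∩ C^⊥ = {0}`. -/
def IsLCD {R : Type*} [CommRing R] {n : ℕ} (C : Submodule R (Fin n → R)) : Prop :=
  C ⊓ dualCode C = ⊥

/-- If `A` is an `n × n` orthogonal matrix over `F_q` and `A_k` is obtained by keeping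
any `k` of its rows, then the row space of `A_k` is an LCD code of dimension `k`. -/
theorem lcd_of_orthogonal_rows {F : Type*} [Field F] [Fintype F] {n k : ℕ}
    (A : Matrix (Fin n) (Fin n) F) (hA : A * A.transpose = 1)
    (rows : Fin k → Fin n) (hrows : Function.Injective rows) :
    Module.finrank F (Submodule.span F (Set.range fun i => A (rows i))) = k ∧
      IsLCD (Submodule.span F (Set.range fun i => A (rows i))) := by
  have key : ∀ (c : Fin k → F) (j : Fin k),
      ∑ t, (∑ i, c i • A (rows i)) t * A (rows j) t = c j := by
    intro c j
    have h : ∀ i, ∑ t, A (rows i) t * A (rows j) t = if i = j then 1 else 0 := by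
      intro i
      have h1 := congrFun (congrFun hA (rows i)) (rows j)
      simpa [Matrix.mul_apply, Matrix.one_apply, hrows.eq_iff] using h1
    simp only [Finset.sum_apply, Pi.smul_apply, smul_eq_mul, Finset.sum_mul]
    rw [Finset.sum_comm]
    simp only [mul_assoc, ← Finset.mul_sum, h]
    simp
  constructor
  · have hli : LinearIndependent F (fun i => A (rows i)) := by
      rw [Fintype.linearIndependent_iff]
      intro g hg j
      rw [← key g j, hg]
      simp
    rw [finrank_span_eq_card hli, Fintype.card_fin]
  · unfold IsLCD
    rw [eq_bot_iff]
    rintro x ⟨hx, hd⟩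
    obtain ⟨c, rfl⟩ := (Submodule.mem_span_range_iff_exists_fun F).1 hx
    have hc : ∀ j, c j = 0 := by
      intro j
      rw [← key c j]
      exact hd _ (Submodule.subset_span ⟨j, rfl⟩)
    simp [hc]
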